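/- Let d ≥ 2 and j, k ∈ {1,…,d}. Define 𝒥^{(jk)}(m) = c_d m_j m_k |m|^{−(d+2)} (U(m) + 1) for m ∈ ℤ^d \ {0} and 𝒥^{(jk)}(0) = 0. Then there is a constant C depending only on d such that ‖𝒥^{(jk)}‖_{ℓ¹(ℤ^d)} = Σ_{m ∈ ℤ^d} |𝒥^{(jk)}(m)| ≤ C. -/

import Mathlib

open MeasureTheory Real Filter

noncomputable section

/-- The lattice ℤ^d. -/
abbrev ZLat (d : ℕ) := Fin d → ℤ

/-- Embedding of the lattice ℤ^d into Euclidean space ℝ^d. -/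
def latVec {d : ℕ} (m : ZLat d) : EuclideanSpace ℝ (Fin d) := WithLp.toLp 2 fun i => (m i : ℝ)

/-- The (Gaussian) heat kernel on ℝ^d. -/
def heatK (d : ℕ) (t : ℝ) (x : EuclideanSpace ℝ (Fin d)) : ℝ :=
  (2 * π * t) ^ (-(d : ℝ) / 2) * Real.exp (-‖x‖ ^ 2 / (2 * t))

/-- The periodic heat kernel H_t(x) = Σ_{n ∈ ℤ^d} P_t(x − n). -/
def pHeatK (d : ℕ) (t : ℝ) (x : EuclideanSpace ℝ (Fin d)) : ℝ :=
  ∑' n : ZLat d, heatK d t (x - latVec n)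

/-- Partial derivative in the j-th coordinate direction. -/
def pderiv {d : ℕ} (j : Fin d) (f : EuclideanSpace ℝ (Fin d) → ℝ)
    (x : EuclideanSpace ℝ (Fin d)) : ℝ :=
  fderiv ℝ f x (EuclideanSpace.single j 1)

/-- The constant c_d = π^{-d/2} Γ((d+2)/2). -/
def cConst (d : ℕ) : ℝ := π ^ (-(d : ℝ) / 2) * Real.Gamma (((d : ℝ) + 2) / 2)

/-- The discrete second-order Riesz kernel K_dis^{(jk)}. -/
def discK (d : ℕ) (j k : Fin d) (m : ZLat d) : ℝ :=
  if m = 0 then 0 else cConst d * (m j : ℝ) * (m k : ℝ) / ‖latVec m‖ ^ (d + 2)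

/-- The discrete second-order Riesz transform R_dis^{(jk)}. -/
def Rdis (d : ℕ) (j k : Fin d) (f : ZLat d → ℝ) (n : ZLat d) : ℝ :=
  ∑' m : ZLat d, discK d j k m * f (n - m)

/-- The probabilistic kernel 𝒦^{(jk)}(m). -/
def probK (d : ℕ) (j k : Fin d) (m : ZLat d) : ℝ :=
  -∫ s in Set.Ioi (0 : ℝ), ∫ x : EuclideanSpace ℝ (Fin d),
      pHeatK d s x *
        (pderiv j (fun y => heatK d s y / pHeatK d s y) x *
         pderiv k (fun y => heatK d s (y - latVec m) / pHeatK d s y) x)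

/-- The probabilistic discrete second-order Riesz transform 𝓡^{(jk)}. -/
def Rprob (d : ℕ) (j k : Fin d) (f : ZLat d → ℝ) (n : ZLat d) : ℝ :=
  ∑' m : ZLat d, probK d j k (n - m) * f m

/-- The ℓ^p norm of f : ℤ^d → ℝ. -/
def lpN (d : ℕ) (p : ℝ) (f : ZLat d → ℝ) : ℝ := (∑' n : ZLat d, |f n| ^ p) ^ (1 / p)

/-- Membership in ℓ^p(ℤ^d). -/
def MemLpLat (d : ℕ) (p : ℝ) (f : ZLat d → ℝ) : Prop := Summable fun n : ZLat d => |f n| ^ p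

/-- Operator norm of an operator on ℓ^p(ℤ^d): sup of ‖Tf‖ over ‖f‖ = 1. -/
def opN (d : ℕ) (p : ℝ) (T : (ZLat d → ℝ) → (ZLat d → ℝ)) : ℝ :=
  sSup {c : ℝ | ∃ f : ZLat d → ℝ, MemLpLat d p f ∧ lpN d p f = 1 ∧ c = lpN d p (T f)}

/-- p* = max{p, p/(p-1)}. -/
def pstar (p : ℝ) : ℝ := max p (p / (p - 1))


/-- The function U(x), extended to real arguments. -/
def Ufun (d : ℕ) (x : EuclideanSpace ℝ (Fin d)) : ℝ :=
  -(π ^ ((d : ℝ) / 2) * Real.Gamma (((d : ℝ) + 2) / 2))⁻¹ *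
    ∫ s in Set.Ioi (0 : ℝ), ∫ z : EuclideanSpace ℝ (Fin d),
      s ^ ((d : ℝ) / 2) * Real.exp (-s - ‖z‖ ^ 2) /
        pHeatK d (‖x‖ ^ 2 / (4 * s)) ((‖x‖ / (2 * Real.sqrt s)) • z + (2 : ℝ)⁻¹ • x)

/-- The kernel 𝒥^{(jk)}(m) = c_d m_j m_k |m|^{-(d+2)} (U(m)+1). -/
def Jker (d : ℕ) (j k : Fin d) (m : ZLat d) : ℝ :=
  if m = 0 then 0
  else cConst d * (m j : ℝ) * (m k : ℝ) / ‖latVec m‖ ^ (d + 2) * (Ufun d (latVec m) + 1)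

theorem hasSum_pi_prod (d : ℕ) (f : Fin d → ℤ → ℝ) (a : Fin d → ℝ)
    (hf : ∀ i n, 0 ≤ f i n) (h : ∀ i, HasSum (f i) (a i)) :
    HasSum (fun n : Fin d → ℤ => ∏ i, f i (n i)) (∏ i, a i) := by
  induction d with
  | zero => simpa using hasSum_unique (fun n : Fin 0 → ℤ => ∏ i, f i (n i))
  | succ d ih =>
    have h1 := ih (fun i => f i.succ) (fun i => a i.succ) (fun i n => hf _ _) (fun i => h _)
    have h3 : Summable (fun p : ℤ × (Fin d → ℤ) => f 0 p.1 * ∏ i : Fin d, f i.succ (p.2 i)) :=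
      Summable.mul_of_nonneg (f := f 0) (g := fun n : Fin d → ℤ => ∏ i : Fin d, f i.succ (n i))
        (h 0).summable h1.summable (hf 0) (fun n => Finset.prod_nonneg fun i _ => hf _ _)
    have h2 := HasSum.mul (h 0) h1 h3
    rw [Fin.prod_univ_succ]
    rw [← (Fin.consEquiv (fun _ : Fin (d+1) => ℤ)).hasSum_iff]
    have e : ((fun n : Fin (d+1) → ℤ => ∏ i, f i (n i)) ∘ (Fin.consEquiv (fun _ : Fin (d+1) => ℤ))) =
        fun p : ℤ × (Fin d → ℤ) => f 0 p.1 * ∏ i : Fin d, f i.succ (p.2 i) := by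
      funext p
      simp [Fin.prod_univ_succ, Fin.consEquiv]
    rw [e]
    exact h2

/-- one-dimensional periodic kernel -/
def hK (t y : ℝ) : ℝ := HurwitzZeta.cosKernel ((-y : ℝ) : UnitAddCircle) (2 * π * t)

theorem hK_hasSum (t y : ℝ) (ht : 0 < t) :
    HasSum (fun n : ℤ => (2 * π * t) ^ (-(1:ℝ)/2) * Real.exp (-(y - n)^2 / (2 * t))) (hK t y) := by
  have hT : 0 < 2 * π * t := by positivity
  have h := (HurwitzZeta.hasSum_int_evenKernel (-y) (t := 1 / (2 * π * t)) (by positivity)).mul_left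
    ((2 * π * t) ^ (-(1:ℝ)/2))
  rw [HurwitzZeta.evenKernel_functional_equation, one_div_one_div, ← mul_assoc] at h
  have e : (2 * π * t) ^ (-(1:ℝ)/2) * (1 / (1 / (2 * π * t)) ^ (1/2:ℝ)) = 1 := by
    rw [one_div (2 * π * t), Real.inv_rpow hT.le, one_div, inv_inv, ← Real.rpow_add hT]
    norm_num
  rw [e, one_mul] at h
  have e2 : (fun n : ℤ => (2 * π * t) ^ (-(1:ℝ)/2) * Real.exp (-(y - n)^2 / (2 * t))) =
      fun n : ℤ => (2 * π * t) ^ (-(1:ℝ)/2) * Real.exp (-π * (n + -y)^2 * (1 / (2 * π * t))) := by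
    funext n
    congr 2
    field_simp
    ring
  rw [e2]
  exact h

theorem hK_sub_one (t y : ℝ) (ht : 0 < t) : |hK t y - 1| ≤ 1 / (6 * t) := by
  have hT : 0 < 2 * π * t := by positivity
  have h := HurwitzZeta.hasSum_nat_cosKernel₀ (-y) hT
  have h2 : HasSum (fun n : ℕ => (1 / (π^2 * t)) * (1 / ((n + 1 : ℕ) : ℝ)^2)) (1 / (π^2 * t) * (π^2/6)) := by
    apply HasSum.mul_left
    have := hasSum_zeta_two
    rw [← hasSum_nat_add_iff' 1] at this
    simpa using this
  have e : 1 / (π^2 * t) * (π^2/6) = 1 / (6 * t) := by field_simp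
  rw [e] at h2
  unfold hK
  rw [← h.tsum_eq, ← Real.norm_eq_abs]
  refine tsum_of_norm_bounded h2 fun n => ?_
  rw [norm_mul, norm_mul, Real.norm_eq_abs, Real.norm_eq_abs, Real.norm_eq_abs, Real.abs_exp]
  have c := Real.abs_cos_le_one (2 * π * -y * (n + 1))
  have x0 : 0 < π * ((n:ℝ) + 1)^2 * (2 * π * t) := by positivity
  have ex : Real.exp (-π * ((n:ℝ) + 1)^2 * (2 * π * t)) ≤ 1 / (π * ((n:ℝ) + 1)^2 * (2 * π * t)) := by
    rw [show -π * ((n:ℝ) + 1)^2 * (2 * π * t) = -(π * ((n:ℝ) + 1)^2 * (2 * π * t)) by ring, Real.exp_neg,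
      ← one_div]
    apply one_div_le_one_div_of_le x0
    linarith [Real.add_one_le_exp (π * ((n:ℝ) + 1)^2 * (2 * π * t))]
  calc |2| * |Real.cos (2 * π * -y * (n + 1))| * Real.exp (-π * ((n:ℝ) + 1)^2 * (2 * π * t))
      ≤ 2 * 1 * (1 / (π * ((n:ℝ) + 1)^2 * (2 * π * t))) := by
        rw [abs_two]; gcongr
    _ = _ := by push_cast; field_simp

theorem hK_lower (t y : ℝ) (ht : 0 < t) :
    (2 * π * t) ^ (-(1:ℝ)/2) * Real.exp (-(1 / (8 * t))) ≤ hK t y := by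
  have h := hK_hasSum t y ht
  refine le_trans ?_ (le_hasSum h (round y) fun n _ => by positivity)
  gcongr
  have := abs_sub_round y
  have h3 : (y - round y)^2 ≤ (1/2)^2 := sq_le_sq' (by linarith [(abs_le.1 this).1]) (abs_le.1 this).2
  rw [neg_div, neg_le_neg_iff, div_le_div_iff₀ (by positivity) (by positivity)]
  nlinarith

theorem hK_pos (t y : ℝ) (ht : 0 < t) : 0 < hK t y :=
  lt_of_lt_of_le (by positivity) (hK_lower t y ht)

theorem hK_inv (t y : ℝ) (ht : 0 < t) : (hK t y)⁻¹ ≤ 4 * Real.exp (1 / (8 * t)) ∧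
    |1 - (hK t y)⁻¹| ≤ 4 * Real.exp (1 / (8 * t)) / t := by
  have hp := hK_pos t y ht
  have e1 : 1 ≤ Real.exp (1 / (8 * t)) := Real.one_le_exp (by positivity)
  rcases le_or_gt 1 t with h | h
  · have h1 := hK_sub_one t y ht
    have h2 : 1 / (6 * t) ≤ 1/6 := by
      apply one_div_le_one_div_of_le <;> linarith
    have h3 : 1/2 ≤ hK t y := by linarith [(abs_le.1 h1).1]
    have h4 : (hK t y)⁻¹ ≤ 2 := by
      rw [inv_le_comm₀ hp (by norm_num)]; linarith
    refine ⟨by linarith, ?_⟩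
    rw [show 1 - (hK t y)⁻¹ = (hK t y - 1) * (hK t y)⁻¹ by field_simp, abs_mul, abs_of_pos (inv_pos.2 hp)]
    calc |hK t y - 1| * (hK t y)⁻¹ ≤ 1 / (6 * t) * 2 := by gcongr
      _ = (1/3) / t := by field_simp; norm_num
      _ ≤ _ := by gcongr; linarith
  · have h4 : (hK t y)⁻¹ ≤ 3 * Real.exp (1 / (8 * t)) := by
      have := inv_anti₀ (by positivity) (hK_lower t y ht)
      rw [mul_inv, ← Real.exp_neg, neg_neg, ← Real.rpow_neg (by positivity)] at this
      refine this.trans ?_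
      gcongr
      rw [neg_div, neg_neg, ← Real.sqrt_eq_rpow, Real.sqrt_le_left (by norm_num)]
      nlinarith [Real.pi_lt_d2, Real.pi_pos]
    refine ⟨by linarith, ?_⟩
    have : 4 * Real.exp (1 / (8 * t)) ≤ 4 * Real.exp (1 / (8 * t)) / t := by
      rw [le_div_iff₀ ht]; nlinarith
    refine le_trans ?_ this
    have := inv_pos.2 hp
    rw [abs_le]; constructor <;> linarith

theorem abs_one_sub_prod (d : ℕ) (q : Fin d → ℝ) (M t : ℝ) (hM : 1 ≤ M) (ht : 0 < t)
    (h0 : ∀ i, 0 ≤ q i) (h1 : ∀ i, q i ≤ M) (h2 : ∀ i, |1 - q i| ≤ M / t) :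
    |1 - ∏ i, q i| ≤ d * M ^ d / t := by
  induction d with
  | zero => simp
  | succ d ih =>
    have := ih (fun i => q i.succ) (fun i => h0 _) (fun i => h1 _) (fun i => h2 _)
    rw [Fin.prod_univ_succ, show 1 - q 0 * ∏ i : Fin d, q i.succ =
      (1 - q 0) + q 0 * (1 - ∏ i : Fin d, q i.succ) by ring]
    refine (abs_add_le _ _).trans ?_
    rw [abs_mul, abs_of_nonneg (h0 0)]
    calc _ ≤ M / t + M * (d * M ^ d / t) := by
          gcongr
          · exact h2 0
          · exact h1 0
      _ ≤ M^(d+1) / t + M * (d * M ^ d / t) := by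
          gcongr
          exact le_self_pow₀ hM (by simp)
      _ = _ := by push_cast; ring

theorem pHeatK_eq (d : ℕ) (t : ℝ) (ht : 0 < t) (x : EuclideanSpace ℝ (Fin d)) :
    pHeatK d t x = ∏ i, hK t (x i) := by
  have hT : 0 < 2 * π * t := by positivity
  rw [← (hasSum_pi_prod d _ _ (fun i n => by positivity) (fun i => hK_hasSum t (x i) ht)).tsum_eq]
  unfold pHeatK heatK
  congr 1; ext n
  rw [Finset.prod_mul_distrib, ← Real.exp_sum, Finset.prod_const, Finset.card_univ, Fintype.card_fin,
    ← Real.rpow_natCast (_ ^ (-(1:ℝ)/2)) d, ← Real.rpow_mul hT.le, EuclideanSpace.norm_sq_eq, ← Finset.sum_div,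
    Finset.sum_neg_distrib]
  congr 2
  · ring
  · simp [latVec]

theorem pHeatK_bound (d : ℕ) (t : ℝ) (ht : 0 < t) (x : EuclideanSpace ℝ (Fin d)) :
    |1 - (pHeatK d t x)⁻¹| ≤ d * 4 ^ d * Real.exp (d / (8 * t)) / t := by
  rw [pHeatK_eq d t ht, ← Finset.prod_inv_distrib]
  have e1 : 1 ≤ Real.exp (1 / (8 * t)) := Real.one_le_exp (by positivity)
  refine (abs_one_sub_prod d _ (4 * Real.exp (1 / (8 * t))) t (by linarith) ht
    (fun i => (inv_pos.2 (hK_pos t _ ht)).le) (fun i => (hK_inv t _ ht).1)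
    (fun i => (hK_inv t _ ht).2)).trans_eq ?_
  rw [mul_pow, ← Real.exp_nat_mul, mul_assoc]
  congr 4
  ring

theorem pHeatK_meas (d : ℕ) :
    Measurable (fun p : ℝ × EuclideanSpace ℝ (Fin d) => pHeatK d p.1 p.2) := by
  unfold pHeatK
  apply Measurable.tsum
  intro n; unfold heatK; fun_prop

theorem latVec_norm_ge (d : ℕ) (m : ZLat d) (i : Fin d) : |(m i : ℝ)| ≤ ‖latVec m‖ := by
  have := PiLp.norm_apply_le (latVec m) i
  simpa [latVec] using this

theorem latVec_norm_one_le (d : ℕ) (m : ZLat d) (hm : m ≠ 0) : 1 ≤ ‖latVec m‖ := by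
  obtain ⟨i, hi⟩ := Function.ne_iff.1 hm
  refine le_trans ?_ (latVec_norm_ge d m i)
  exact_mod_cast Int.one_le_abs hi

theorem summable_int_aux (p : ℝ) (hp : 1 < p) :
    Summable (fun n : ℤ => (1 + |(n : ℝ)|) ^ (-p)) := by
  refine (Real.summable_abs_int_rpow hp).of_norm_bounded_eventually ?_
  rw [Filter.eventually_cofinite]
  refine (Set.finite_singleton (0:ℤ)).subset fun n hn => ?_
  by_contra h
  apply hn
  have h0 : (0:ℝ) < |(n:ℝ)| := by simpa using h
  rw [Real.norm_of_nonneg (by positivity)]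
  exact Real.rpow_le_rpow_of_nonpos h0 (by linarith) (by linarith)

theorem summable_lat (d : ℕ) (hd : 1 ≤ d) :
    Summable (fun m : ZLat d => 1 / ‖latVec m‖ ^ (d + 2)) := by
  have hd' : (0:ℝ) < d := by exact_mod_cast hd
  have h := (hasSum_pi_prod d (fun _ n => (1 + |(n : ℝ)|) ^ (-(1 + 2 / (d:ℝ)))) _
    (fun i n => by positivity) (fun i => (summable_int_aux _ (by
      have : 0 < 2 / (d:ℝ) := by positivity
      linarith)).hasSum)).summable
  refine (h.mul_left (2 ^ (d+2))).of_norm_bounded_eventually ?_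
  rw [Filter.eventually_cofinite]
  refine (Set.finite_singleton (0 : ZLat d)).subset fun m hm => ?_
  by_contra h0
  apply hm
  have h1 := latVec_norm_one_le d m h0
  have hN : 0 < ‖latVec m‖ := by linarith
  rw [Real.norm_of_nonneg (by positivity)]
  have : ∏ i : Fin d, (2 * ‖latVec m‖) ^ (-(1 + 2 / (d:ℝ))) ≤
      ∏ i : Fin d, (1 + |(m i : ℝ)|) ^ (-(1 + 2 / (d:ℝ))) := by
    refine Finset.prod_le_prod (fun i _ => by positivity) fun i _ => ?_
    refine Real.rpow_le_rpow_of_nonpos (by positivity) (by linarith [latVec_norm_ge d m i]) ?_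
    have : 0 < 2 / (d:ℝ) := by positivity
    linarith
  rw [Finset.prod_const, Finset.card_univ, Fintype.card_fin, ← Real.rpow_natCast,
    ← Real.rpow_mul (by positivity), show -(1 + 2 / (d:ℝ)) * d = -((d + 2 : ℕ) : ℝ) by
      push_cast; field_simp, Real.rpow_neg (by positivity), Real.rpow_natCast, mul_pow, mul_inv] at this
  calc 1 / ‖latVec m‖ ^ (d+2) = 2 ^ (d+2) * ((2 ^ (d+2))⁻¹ * (‖latVec m‖ ^ (d+2))⁻¹) := by
        field_simp
    _ ≤ _ := by gcongr

theorem gauss_int (d : ℕ) : ∫ z : EuclideanSpace ℝ (Fin d), Real.exp (-‖z‖^2) = π ^ ((d:ℝ)/2) := by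
  have := GaussianFourier.integral_rexp_neg_mul_sq_norm (V := EuclideanSpace ℝ (Fin d)) (b := 1) one_pos
  simpa using this

theorem gauss_integrable (d : ℕ) :
    Integrable (fun z : EuclideanSpace ℝ (Fin d) => Real.exp (-‖z‖^2)) :=
  Integrable.of_integral_ne_zero (by rw [gauss_int]; positivity)

theorem gamma_integrable (d : ℕ) :
    IntegrableOn (fun s : ℝ => s ^ ((d:ℝ)/2) * Real.exp (-s)) (Set.Ioi 0) := by
  have := Real.GammaIntegral_convergent (s := (d:ℝ)/2 + 1) (by positivity)
  simpa [mul_comm] using this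

theorem gamma_int (d : ℕ) :
    ∫ s in Set.Ioi (0:ℝ), s ^ ((d:ℝ)/2) * Real.exp (-s) = Real.Gamma (((d:ℝ)+2)/2) := by
  rw [Real.Gamma_eq_integral (by positivity)]
  congr 1; ext s
  rw [mul_comm]; congr 2; ring

theorem gamma_integrable2 (d : ℕ) :
    IntegrableOn (fun s : ℝ => s ^ ((d:ℝ)/2+1) * Real.exp (-s/2)) (Set.Ioi 0) := by
  have := integrableOn_rpow_mul_exp_neg_mul_rpow (s := (d:ℝ)/2+1) (p := 1) (b := 1/2)
    (by have : (0:ℝ) ≤ d/2 := by positivity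
        linarith) (by norm_num) (by norm_num)
  refine this.congr_fun (fun s _ => ?_) measurableSet_Ioi
  simp only [Real.rpow_one]
  congr 2; ring

theorem U_bound (d : ℕ) : ∃ C : ℝ, 0 ≤ C ∧ ∀ x : EuclideanSpace ℝ (Fin d), (d:ℝ) ≤ ‖x‖^2 → 1 ≤ ‖x‖ →
    |Ufun d x + 1| ≤ C / ‖x‖^2 := by
  set A := π ^ ((d : ℝ) / 2) * Real.Gamma (((d : ℝ) + 2) / 2) with hA
  have hAp : 0 < A := mul_pos (by positivity) (Real.Gamma_pos_of_pos (by positivity))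
  set μ := (volume.restrict (Set.Ioi (0:ℝ))).prod (volume : Measure (EuclideanSpace ℝ (Fin d))) with hμ
  set B : ℝ × EuclideanSpace ℝ (Fin d) → ℝ := fun p =>
    (p.1 ^ ((d:ℝ)/2+1) * Real.exp (-p.1/2)) * Real.exp (-‖p.2‖^2) with hB
  set G0 : ℝ × EuclideanSpace ℝ (Fin d) → ℝ := fun p =>
    (p.1 ^ ((d:ℝ)/2) * Real.exp (-p.1)) * Real.exp (-‖p.2‖^2) with hG0
  have hBi : Integrable B μ := Integrable.mul_prod (gamma_integrable2 d) (gauss_integrable d)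
  have hG0i : Integrable G0 μ := Integrable.mul_prod (gamma_integrable d) (gauss_integrable d)
  have hG0v : ∫ p, G0 p ∂μ = A := by
    rw [hμ, hG0, integral_prod_mul (fun s : ℝ => s ^ ((d:ℝ)/2) * Real.exp (-s))
      (fun z : EuclideanSpace ℝ (Fin d) => Real.exp (-‖z‖^2)), gamma_int, gauss_int, hA, mul_comm]
  have hpos : ∀ᵐ p ∂μ, 0 < p.1 := by
    have h1 : ∀ᵐ s ∂(volume.restrict (Set.Ioi (0:ℝ))), s ∈ Set.Ioi (0:ℝ) :=
      ae_restrict_mem measurableSet_Ioi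
    exact Measure.quasiMeasurePreserving_fst.ae h1
  have hBn : 0 ≤ ∫ p, B p ∂μ := by
    refine integral_nonneg_of_ae ?_
    filter_upwards [hpos] with p hp
    simp only [hB, Pi.zero_apply]
    positivity
  refine ⟨A⁻¹ * (4 * (d * 4^d) * ∫ p, B p ∂μ), by positivity, fun x hx hx1 => ?_⟩
  have hxp : 0 < ‖x‖ := by linarith
  set G : ℝ × EuclideanSpace ℝ (Fin d) → ℝ := fun p =>
    p.1 ^ ((d : ℝ) / 2) * Real.exp (-p.1 - ‖p.2‖ ^ 2) /
        pHeatK d (‖x‖ ^ 2 / (4 * p.1)) ((‖x‖ / (2 * Real.sqrt p.1)) • p.2 + (2 : ℝ)⁻¹ • x) with hG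
  have hGm : Measurable G := by
    have h1 : Measurable fun p : ℝ × EuclideanSpace ℝ (Fin d) =>
      pHeatK d (‖x‖ ^ 2 / (4 * p.1)) ((‖x‖ / (2 * Real.sqrt p.1)) • p.2 + (2 : ℝ)⁻¹ • x) :=
      (pHeatK_meas d).comp (g := fun p : ℝ × EuclideanSpace ℝ (Fin d) => pHeatK d p.1 p.2)
        (f := fun p : ℝ × EuclideanSpace ℝ (Fin d) =>
          (‖x‖ ^ 2 / (4 * p.1), (‖x‖ / (2 * Real.sqrt p.1)) • p.2 + (2 : ℝ)⁻¹ • x)) (by fun_prop)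
    exact Measurable.div (by fun_prop) h1
  have hbd : ∀ᵐ p ∂μ, ‖G0 p - G p‖ ≤ (4 * (d * 4^d) / ‖x‖^2) * B p := by
    filter_upwards [hpos] with p hp
    obtain ⟨s, z⟩ := p
    simp only at hp
    have ht : 0 < ‖x‖^2 / (4 * s) := by positivity
    have hb := pHeatK_bound d _ ht ((‖x‖ / (2 * Real.sqrt s)) • z + (2 : ℝ)⁻¹ • x)
    have e : G0 (s, z) - G (s, z) = G0 (s, z) * (1 - (pHeatK d (‖x‖ ^ 2 / (4 * s)) ((‖x‖ / (2 * Real.sqrt s)) • z + (2 : ℝ)⁻¹ • x))⁻¹) := by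
      simp only [hG0, hG]
      rw [sub_eq_add_neg (-s), Real.exp_add]
      ring
    have hG0p : 0 ≤ G0 (s, z) := by simp only [hG0]; positivity
    rw [e, norm_mul, Real.norm_of_nonneg hG0p, Real.norm_eq_abs]
    have hexp : Real.exp (d / (8 * (‖x‖^2 / (4 * s)))) ≤ Real.exp (s / 2) := by
      apply Real.exp_le_exp.2
      rw [show (d:ℝ) / (8 * (‖x‖^2 / (4 * s))) = (d / ‖x‖^2) * (s/2) by field_simp; ring]
      have : d / ‖x‖^2 ≤ 1 := by rw [div_le_one (by positivity)]; exact hx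
      nlinarith
    calc _ ≤ G0 (s, z) * (d * 4 ^ d * Real.exp (s/2) / (‖x‖^2 / (4 * s))) := by
          refine mul_le_mul_of_nonneg_left (hb.trans ?_) hG0p
          gcongr
      _ = _ := by
          simp only [hG0, hB]
          rw [Real.rpow_add hp, Real.rpow_one, show -s/2 = -s + s/2 by ring, Real.exp_add]
          field_simp
  have hdi : Integrable (fun p => G0 p - G p) μ :=
    (hBi.const_mul _).mono' (hG0i.aestronglyMeasurable.sub hGm.aestronglyMeasurable) hbd
  have hGi : Integrable G μ := by
    have := hG0i.sub hdi
    refine this.congr (Filter.Eventually.of_forall fun p => ?_)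
    simp
  have hU : Ufun d x = -A⁻¹ * ∫ p, G p ∂μ := by
    rw [hμ, integral_prod _ hGi]
    rfl
  have hfin : Ufun d x + 1 = A⁻¹ * ∫ p, (G0 p - G p) ∂μ := by
    rw [hU, integral_sub hG0i hGi, hG0v]
    field_simp
    ring
  rw [hfin, abs_mul, abs_of_pos (inv_pos.2 hAp), mul_div_assoc]
  gcongr
  rw [← Real.norm_eq_abs]
  refine (norm_integral_le_of_norm_le (hBi.const_mul _) hbd).trans_eq ?_
  rw [integral_const_mul]
  ring

theorem finite_lat (d : ℕ) (R : ℝ) : {m : ZLat d | ‖latVec m‖ < R}.Finite := by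
  refine (Set.finite_Icc (fun _ : Fin d => -⌈R⌉) (fun _ => ⌈R⌉)).subset fun m hm => ?_
  have h : ∀ i, |m i| ≤ ⌈R⌉ := fun i => by
    have h1 : |(m i : ℝ)| ≤ R := (latVec_norm_ge d m i).trans (le_of_lt hm)
    have := h1.trans (Int.le_ceil R)
    exact_mod_cast this
  exact ⟨fun i => (abs_le.1 (h i)).1, fun i => (abs_le.1 (h i)).2⟩

theorem stmt12 (d : ℕ) (hd : 2 ≤ d) (j k : Fin d) :
    ∃ C : ℝ, Summable (fun m : ZLat d => |Jker d j k m|) ∧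
      ∑' m : ZLat d, |Jker d j k m| ≤ C := by
  refine ⟨_, ?_, le_rfl⟩
  obtain ⟨C, hC, hU⟩ := U_bound d
  refine ((summable_lat d (by omega)).mul_left (|cConst d| * C)).of_norm_bounded_eventually ?_
  rw [Filter.eventually_cofinite]
  refine (finite_lat d (d + 1)).subset fun m hm => ?_
  by_contra h0
  apply hm
  have h1 : (d:ℝ) + 1 ≤ ‖latVec m‖ := not_lt.1 h0
  have hd0 : (0:ℝ) ≤ d := by positivity
  have hN : 0 < ‖latVec m‖ := by linarith
  have hm0 : m ≠ 0 := by
    rintro rfl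
    have : latVec (0 : ZLat d) = 0 := by ext i; simp [latVec]
    simp [this] at hN
  have hb := hU (latVec m) (by nlinarith) (by linarith)
  rw [Jker, if_neg hm0, norm_abs_eq_norm, Real.norm_eq_abs, abs_mul, abs_div, abs_mul, abs_mul,
    abs_of_nonneg (by positivity : 0 ≤ ‖latVec m‖ ^ (d+2))]
  calc _ ≤ |cConst d| * ‖latVec m‖ * ‖latVec m‖ / ‖latVec m‖ ^ (d+2) * (C / ‖latVec m‖^2) := by
        gcongr
        · exact latVec_norm_ge d m j
        · exact latVec_norm_ge d m k
    _ = _ := by field_simp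

end
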